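/- Let k be a field, A a finitely generated k-algebra which is an integral domain, and let k' be the relative algebraic closure of k in the fraction field of A. If k' = k (i.e., k is algebraically closed in Frac(A)), then for every field extension L/k with L algebraically closed, the ring A ⊗_k L is an integral domain. -/

import Mathlib

open scoped TensorProduct
open Polynomial


lemma exists_point (F B : Type) [Field F] [IsAlgClosed F] [CommRing B] [IsDomain B] [Algebra F B]
    [Algebra.FiniteType F B] (b : B) (hb : b ≠ 0) : ∃ φ : B →ₐ[F] F, φ b ≠ 0 := by
  have : IsJacobsonRing B := isJacobsonRing_of_finiteType (A := F)
  have h : b ∉ (⊥ : Ideal B).jacobson := by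
    rw [← Ideal.radical_eq_jacobson, (Ideal.isPrime_bot (α := B)).radical]
    simpa using hb
  rw [Ideal.jacobson, Ideal.mem_sInf] at h
  push Not at h
  obtain ⟨m, ⟨-, hm⟩, hbm⟩ := h
  letI := Ideal.Quotient.field m
  have : Module.Finite F (B ⧸ m) := finite_of_finite_type_of_isJacobsonRing F (B ⧸ m)
  let e := AlgEquiv.ofBijective (Algebra.ofId F (B ⧸ m))
    (IsAlgClosed.algebraMap_bijective_of_isIntegral (k := F) (K := B ⧸ m))
  refine ⟨(e.symm : (B ⧸ m) →ₐ[F] F).comp (Ideal.Quotient.mkₐ F m), ?_⟩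
  simp
  rwa [Ideal.Quotient.eq_zero_iff_mem]

lemma isDomain_of_algClosed (F B L : Type) [Field F] [IsAlgClosed F] [CommRing B] [IsDomain B]
    [Algebra F B] [Algebra.FiniteType F B] [Field L] [Algebra F L] : IsDomain (B ⊗[F] L) := by
  have : Nontrivial (B ⊗[F] L) :=
    (Algebra.TensorProduct.includeLeft_injective (S := F) (A := B) (B := L)
      (algebraMap F L).injective).nontrivial
  let e := Module.Basis.ofVectorSpace F L
  let E := Algebra.TensorProduct.basis B e
  suffices NoZeroDivisors (B ⊗[F] L) from NoZeroDivisors.to_isDomain _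
  have key (φ : B →ₐ[F] F) (x : B ⊗[F] L)
      (hx : Algebra.TensorProduct.lift ((Algebra.ofId F L).comp φ) (AlgHom.id F L)
        (fun _ _ => Commute.all _ _) x = 0) (i) : φ (E.repr x i) = 0 := by
    have h1 : Algebra.TensorProduct.lift ((Algebra.ofId F L).comp φ) (AlgHom.id F L)
        (fun _ _ => Commute.all _ _) x = ∑ i ∈ (E.repr x).support, φ (E.repr x i) • e i := by
      conv_lhs => rw [← E.linearCombination_repr x]
      rw [Finsupp.linearCombination_apply, Finsupp.sum, map_sum]
      refine Finset.sum_congr rfl fun i _ => ?_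
      simp [E, TensorProduct.smul_tmul', Algebra.smul_def, Algebra.ofId_apply]
    rw [h1] at hx
    by_cases hi : i ∈ (E.repr x).support
    · exact linearIndependent_iff'.1 e.linearIndependent _ _ hx i hi
    · rw [Finsupp.notMem_support_iff.1 hi, map_zero]
  refine ⟨fun {x y} hxy => ?_⟩
  by_contra! h
  obtain ⟨i, hi⟩ : ∃ i, E.repr x i ≠ 0 := by
    by_contra! h'; exact h.1 (E.repr.map_eq_zero_iff.1 (Finsupp.ext h'))
  obtain ⟨j, hj⟩ : ∃ i, E.repr y i ≠ 0 := by
    by_contra! h'; exact h.2 (E.repr.map_eq_zero_iff.1 (Finsupp.ext h'))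
  obtain ⟨φ, hφ⟩ := exists_point F B _ (mul_ne_zero hi hj)
  have := congrArg (Algebra.TensorProduct.lift ((Algebra.ofId F L).comp φ) (AlgHom.id F L)
        (fun _ _ => Commute.all _ _)) hxy
  rw [map_mul, map_zero, mul_eq_zero] at this
  rw [map_mul] at hφ
  rcases this with h | h
  · exact hφ (by rw [key φ x h i, zero_mul])
  · exact hφ (by rw [key φ y h j, mul_zero])

lemma minpoly_reg (k K M : Type) [Field k] [Field K] [Field M] [Algebra k K] [Algebra K M]
    [Algebra k M] [IsScalarTower k K M]
    (hreg : ∀ x : K, IsAlgebraic k x → ∃ c : k, algebraMap k K c = x) (a : M)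
    (ha : IsIntegral k a) : (minpoly K a).natDegree = (minpoly k a).natDegree := by
  have hd : minpoly K a ∣ (minpoly k a).map (algebraMap k K) := minpoly.dvd_map_of_isScalarTower k K a
  have hl := integralClosure.mem_lifts_of_monic_of_dvd_map K (minpoly.monic ha)
    (minpoly.monic ha.tower_top) hd
  have : minpoly K a ∈ lifts (algebraMap k K) := by
    rw [lifts_iff_coeff_lifts] at hl ⊢
    intro n
    obtain ⟨c, hc⟩ := hl n
    obtain ⟨d, hd⟩ := hreg c c.2.isAlgebraic
    exact ⟨d, by rw [hd, ← hc]; rfl⟩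
  obtain ⟨q, hq⟩ := (mem_lifts _).1 this
  have hqm : q.Monic := by
    have := minpoly.monic (ha.tower_top (A := K)); rw [← hq] at this
    exact Polynomial.monic_of_injective (algebraMap k K).injective this
  apply le_antisymm
  · simpa using natDegree_le_of_dvd hd ((minpoly.monic ha).map _).ne_zero
  · rw [← hq, natDegree_map]
    refine natDegree_le_of_dvd (minpoly.dvd k a ?_) hqm.ne_zero
    rw [← aeval_map_algebraMap K, hq, minpoly.aeval]

lemma disj (k K M : Type) [Field k] [CharZero k] [Field K] [Field M] [Algebra k K] [Algebra K M]
    [Algebra k M] [IsScalarTower k K M]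
    (hreg : ∀ x : K, IsAlgebraic k x → ∃ c : k, algebraMap k K c = x) :
    (algebraicClosure k M).LinearDisjoint K := by
  rw [IntermediateField.linearDisjoint_iff]
  have : Algebra.IsIntegral k (algebraicClosure k M).toSubalgebra :=
    inferInstanceAs (Algebra.IsIntegral k (algebraicClosure k M))
  refine Subalgebra.LinearDisjoint.of_linearDisjoint_finite_left _ _ fun B' _ _ => ?_
  let E : IntermediateField k M := B'.toIntermediateField'
    (isField_of_isIntegral_of_isField' (Field.toIsField k))
  change E.toSubalgebra.LinearDisjoint _
  have : FiniteDimensional k E := inferInstanceAs (Module.Finite k B')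
  rw [← IntermediateField.linearDisjoint_iff]
  let pb := Field.powerBasisOfFiniteOfSeparable k E
  refine IntermediateField.LinearDisjoint.of_basis_left pb.basis ?_
  have hi : IsIntegral k (pb.gen : M) := (Algebra.IsIntegral.isIntegral pb.gen).algebraMap
  have hdim : (minpoly K (pb.gen : M)).natDegree = pb.dim := by
    rw [minpoly_reg k K M hreg _ hi, ← pb.natDegree_minpoly]
    exact congrArg _ (minpoly.algebraMap_eq (algebraMap E M).injective pb.gen)
  have := linearIndependent_pow (K := K) (pb.gen : M)
  rw [hdim] at this
  convert this using 1
  ext i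
  simp

theorem stmt_9 (k A : Type) [Field k] [CharZero k] [CommRing A] [IsDomain A]
    [Algebra k A] [Algebra.FiniteType k A]
    (hreg : ∀ x : FractionRing A, IsAlgebraic k x →
      ∃ c : k, algebraMap k (FractionRing A) c = x)
    (L : Type) [Field L] [Algebra k L] [IsAlgClosed L] :
    IsDomain (TensorProduct k A L) := by
  let K := FractionRing A
  let M := AlgebraicClosure K
  let C := algebraicClosure k M
  let F := algebraicClosure k L
  have hC : IsDomain (C ⊗[k] K) := (disj k K M hreg).isDomain
  have : IsAlgClosed F := (inferInstance : IsAlgClosure k F).isAlgClosed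
  let e : F ≃ₐ[k] C := IsAlgClosure.equiv k F C
  let f : F ⊗[k] A →ₐ[k] C ⊗[k] K :=
    Algebra.TensorProduct.map (e : F →ₐ[k] C) (IsScalarTower.toAlgHom k A K)
  have hf : Function.Injective f :=
    TensorProduct.map_injective_of_flat_flat _ _ e.injective (IsFractionRing.injective A K)
  have hF : IsDomain (F ⊗[k] A) := hf.isDomain f.toRingHom
  have := isDomain_of_algClosed F (F ⊗[k] A) L
  exact ((Algebra.TensorProduct.comm k A L).trans
    (((Algebra.TensorProduct.cancelBaseChange k F F L A).symm.trans
      (Algebra.TensorProduct.comm F L (F ⊗[k] A))).restrictScalars k)).toMulEquiv.isDomain
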